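/- arXiv:2104.13178 — 2 statements merged into one kernel-verified Lean document; each statement's English description precedes it below -/
import Mathlib

section
/- Let E be a real normed space and B : E → (E →L E →L E) a field of continuous bilinear maps. Let c : I → E be twice differentiable on an interval I with c''(t) = B(c(t))(c'(t))(c'(t)) and c'(t) ≠ 0 for all t ∈ I, and let r : J → I be a twice differentiable function on an interval J. Then the reparametrized curve c ∘ r satisfies (c∘r)''(s) = B((c∘r)(s))((c∘r)'(s))((c∘r)'(s)) for all s ∈ J if and only if r''(s) = 0 for all s ∈ J, i.e. if and only if r is affine, r(s) = a s + b. (This is the ODE content of the lemma that a reparametrization of a nonzero-velocity nonholonomic geodesic is again a nonholonomic geodesic exactly when the reparametrization is affine.) -/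
/-- A function whose derivative is a constant `a` on a convex set of reals is affine there. -/
theorem Convex.eq_add_mul_of_hasDerivAt_const {J : Set ℝ} (hJ : Convex ℝ J) {f : ℝ → ℝ} {a : ℝ}
    (hf : ∀ s ∈ J, HasDerivAt f a s) {x y : ℝ} (hx : x ∈ J) (hy : y ∈ J) :
    f y = f x + a * (y - x) := by
  have h := hJ.norm_image_sub_le_of_norm_hasDerivWithin_le (f := fun s => f s - a * s)
    (f' := fun _ => 0) (C := 0)
    (fun s hs => by
      simpa using ((hf s hs).fun_sub ((hasDerivAt_id s).const_mul a)).hasDerivWithinAt)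
    (by simp) hx hy
  rw [zero_mul, norm_le_zero_iff] at h
  linarith


/-- A reparametrization `c ∘ r` of a nonzero-velocity solution of the second-order ODE
`c'' = B(c)(c')(c')` is again a solution iff `r'' = 0` on `J`, i.e. iff `r` is affine. -/
theorem stmt10 {E : Type*} [NormedAddCommGroup E] [NormedSpace ℝ E]
    (B : E → E →L[ℝ] E →L[ℝ] E)
    (I J : Set ℝ) (hJ : J.OrdConnected) (hJnt : J.Nontrivial)
    (c c' : ℝ → E) (r r' r'' : ℝ → ℝ)
    (hmaps : Set.MapsTo r J I)
    (hc : ∀ t ∈ I, HasDerivAt c (c' t) t)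
    (hc' : ∀ t ∈ I, HasDerivAt c' (B (c t) (c' t) (c' t)) t)
    (hne : ∀ t ∈ I, c' t ≠ 0)
    (hr : ∀ s ∈ J, HasDerivAt r (r' s) s)
    (hr' : ∀ s ∈ J, HasDerivAt r' (r'' s) s) :
    ((∀ s ∈ J, HasDerivAt (fun s => r' s • c' (r s))
        (B ((c ∘ r) s) (r' s • c' (r s)) (r' s • c' (r s))) s) ↔
      (∀ s ∈ J, r'' s = 0)) ∧
    ((∀ s ∈ J, r'' s = 0) ↔ ∃ a b : ℝ, ∀ s ∈ J, r s = a * s + b) := by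
  have hU := uniqueDiffOn_convex hJ.convex (hJ.convex.nontrivial_iff_nonempty_interior.1 hJnt)
  refine ⟨forall₂_congr fun s hs => ?_, fun h0 => ?_, ?_⟩
  · have ht := hmaps hs
    have hd : HasDerivAt (fun s => r' s • c' (r s))
        (r' s • r' s • B (c (r s)) (c' (r s)) (c' (r s)) + r'' s • c' (r s)) s :=
      (hr' s hs).smul ((hc' (r s) ht).scomp s (hr s hs))
    have hB : B ((c ∘ r) s) (r' s • c' (r s)) (r' s • c' (r s)) =
        r' s • r' s • B (c (r s)) (c' (r s)) (c' (r s)) := by simp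
    rw [hB]
    refine ⟨fun h => ?_, fun h => by simpa [h] using hd⟩
    have h1 := hd.unique h
    rw [add_eq_left, smul_eq_zero] at h1
    exact h1.resolve_right (hne _ ht)
  · obtain ⟨x, hx⟩ := hJnt.nonempty
    have hconst : ∀ s ∈ J, r' s = r' x := fun s hs => by
      simpa using hJ.convex.eq_add_mul_of_hasDerivAt_const (f := r') (a := 0)
        (fun t ht => h0 t ht ▸ hr' t ht) hx hs
    refine ⟨r' x, r x - r' x * x, fun s hs => ?_⟩
    rw [hJ.convex.eq_add_mul_of_hasDerivAt_const (f := r) (a := r' x)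
      (fun t ht => hconst t ht ▸ hr t ht) hx hs]
    ring
  · rintro ⟨a, b, hab⟩ s hs
    have hconst : ∀ t ∈ J, r' t = a := fun t ht => by
      have h : HasDerivWithinAt (fun u => a * u + b) a J t := by
        simpa using (((hasDerivAt_id t).const_mul a).add_const b).hasDerivWithinAt
      exact (hU t ht).eq_deriv _ (hr t ht).hasDerivWithinAt (h.congr hab (hab t ht))
    exact (hU s hs).eq_deriv _ (hr' s hs).hasDerivWithinAt
      ((hasDerivWithinAt_const s J a).congr hconst (hconst s hs))
end

section
/- Fix e ∈ ℝ and define F, G : ℝ⁵ → ℝ⁵ by F = (p₁/(y²+1), p₂, y p₁/(y²+1), y p₁ p₂/(y²+1) − y, 0) and G = ((1/(e−z)) p₁/(y²+1), (1/(e−z)) p₂, (1/(e−z)) y p₁/(y²+1), (1/(e−z)) y p₁ p₂/(y²+1) − (y/(2(e−z)²))(p₁²/(y²+1) + p₂²), 0) in coordinates (x,y,z,p₁,p₂). Let γ : ℝ → ℝ⁵ be differentiable with γ'(t) = F(γ(t)), suppose that along γ one has z < e and (1/2)(p₁²/(y²+1) + p₂²) + z = e, and let k : ℝ → ℝ be differentiable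 with k'(t) = 1/(e − z(γ(k(t)))). Then the reparametrized curve γ ∘ k satisfies (γ∘k)'(t) = G((γ∘k)(t)) for all t. (This is the nonholonomic Maupertuis–Jacobi principle for the particle in ℝ³ with potential V = z and constraint ż = yẋ: mechanical trajectories with energy e are reparametrizations of the Jacobi kinetic nonholonomic trajectories.) -/
/-- Right-hand side of the nonholonomic Hamilton equations of the mechanical system on
`ℝ³` with euclidean metric, potential `V = z` and constraint `ż = yẋ`, in adapted
coordinates `(x, y, z, p₁, p₂) = (q 0, q 1, q 2, q 3, q 4)`. -/
noncomputable def F14 : (Fin 5 → ℝ) → (Fin 5 → ℝ) := fun q =>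
  ![q 3 / ((q 1)^2 + 1), q 4, q 1 * q 3 / ((q 1)^2 + 1),
    q 1 * q 3 * q 4 / ((q 1)^2 + 1) - q 1, 0]

/-- Right-hand side of the nonholonomic Hamilton equations of the associated Jacobi
kinetic system on `U_e = {z < e}`. -/
noncomputable def G14 (e : ℝ) : (Fin 5 → ℝ) → (Fin 5 → ℝ) := fun q =>
  ![(1/(e - q 2)) * (q 3 / ((q 1)^2 + 1)),
    (1/(e - q 2)) * q 4,
    (1/(e - q 2)) * (q 1 * q 3 / ((q 1)^2 + 1)),
    (1/(e - q 2)) * (q 1 * q 3 * q 4 / ((q 1)^2 + 1)) -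
      (q 1 / (2*(e - q 2)^2)) * ((q 3)^2 / ((q 1)^2 + 1) + (q 4)^2),
    0]

/-- On the energy level set, the Jacobi kinetic vector field is the mechanical vector field
multiplied by `1 / (e - z)`. -/
theorem G14_eq_smul_F14 {e : ℝ} {q : Fin 5 → ℝ} (hz : q 2 < e)
    (hE : (1/2) * ((q 3)^2 / ((q 1)^2 + 1) + (q 4)^2) + q 2 = e) :
    G14 e q = (1/(e - q 2)) • F14 q := by
  have hne : e - q 2 ≠ 0 := (sub_pos.mpr hz).ne'
  have hkin : (q 3)^2 / ((q 1)^2 + 1) + (q 4)^2 = 2 * (e - q 2) := by linarith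
  have hy : (q 1)^2 + 1 ≠ 0 := by positivity
  simp only [F14, G14, hkin, Matrix.smul_cons, smul_eq_mul, mul_zero, Matrix.smul_empty]
  congr 4
  field_simp

/-- Nonholonomic Maupertuis–Jacobi principle for the particle in `ℝ³` with potential
`V = z` and constraint `ż = yẋ`: mechanical trajectories with energy `e` are
reparametrizations of the Jacobi kinetic nonholonomic trajectories. -/
theorem stmt14 (e : ℝ) (γ : ℝ → Fin 5 → ℝ)
    (hγ : ∀ t, HasDerivAt γ (F14 (γ t)) t)
    (hz : ∀ t, γ t 2 < e)
    (hE : ∀ t, (1/2) * ((γ t 3)^2 / ((γ t 1)^2 + 1) + (γ t 4)^2) + γ t 2 = e)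
    (k : ℝ → ℝ)
    (hk : ∀ t, HasDerivAt k (1/(e - γ (k t) 2)) t) :
    ∀ t, HasDerivAt (γ ∘ k) (G14 e ((γ ∘ k) t)) t := by
  intro t
  rw [Function.comp_apply, G14_eq_smul_F14 (hz (k t)) (hE (k t))]
  exact (hγ (k t)).scomp t (hk t)
end
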